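/- arXiv:1704.01907 — 2 statements merged into one kernel-verified Lean document; each statement's English description precedes it below -/
import Mathlib

section
/- Suppose the square S₀ is occupied and the component C(0) is finite. Then there exists a plus connected S-cycle (V₁,…,V_s) such that every square V_i is vacant and star adjacent to some square of C(0), and the set {V₁,…,V_s} surrounds every square of C(0). -/
/-- Squares indexed by `ℤ × ℤ`; star adjacency: share at least a corner. -/
def starAdj (i j : ℤ × ℤ) : Prop := max |i.1 - j.1| |i.2 - j.2| = 1

/-- Plus adjacency: share an edge. -/
def plusAdj (i j : ℤ × ℤ) : Prop := |i.1 - j.1| + |i.2 - j.2| = 1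

/-- `q` is reachable from `p` by a star connected S-path (pairwise distinct squares,
consecutive squares star adjacent) avoiding all squares of `avoid`. -/
def starReach (avoid : Set (ℤ × ℤ)) (p q : ℤ × ℤ) : Prop :=
  ∃ L : List (ℤ × ℤ), L.Nodup ∧ L.Chain' starAdj ∧ L.head? = some p ∧
    L.getLast? = some q ∧ ∀ x ∈ L, x ∉ avoid

/-- The star connected occupied component of the square `S₀ = S_{(0,0)}`. -/
def C0 (ω : ℤ × ℤ → Bool) : Set (ℤ × ℤ) :=
  {k | ω k = true ∧ starReach {x | ω x = false} (0, 0) k}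

/-- A set `L` of squares surrounds the square `S ∉ L` if the set of squares reachable
from `S` by star connected S-paths avoiding all squares of `L` is finite. -/
def surrounds (L : Set (ℤ × ℤ)) (S : ℤ × ℤ) : Prop :=
  S ∉ L ∧ {k | starReach L S k}.Finite

/-- A plus connected S-cycle: pairwise distinct squares `(J₁, …, J_m)` with
`(J₁, …, J_{m-1})` a plus connected S-path and `J_m` plus adjacent to both
`J_{m-1}` and `J₁`. -/
def IsPlusCycle (V : List (ℤ × ℤ)) : Prop :=
  V ≠ [] ∧ V.Nodup ∧ V.Chain' plusAdj ∧
    ∃ a b, V.head? = some a ∧ V.getLast? = some b ∧ plusAdj b a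


namespace PlusCycleAux

theorem star_cases {p q : ℤ × ℤ} (h : starAdj p q) :
    -1 ≤ p.1 - q.1 ∧ p.1 - q.1 ≤ 1 ∧ -1 ≤ p.2 - q.2 ∧ p.2 - q.2 ≤ 1 := by
  unfold starAdj at h
  have h1 : |p.1 - q.1| ≤ 1 := h ▸ le_max_left _ _
  have h2 : |p.2 - q.2| ≤ 1 := h ▸ le_max_right _ _
  rw [abs_le] at h1 h2
  exact ⟨h1.1, h1.2, h2.1, h2.2⟩

theorem star_of {p q : ℤ × ℤ} (hne : p ≠ q)
    (h : -1 ≤ p.1 - q.1 ∧ p.1 - q.1 ≤ 1 ∧ -1 ≤ p.2 - q.2 ∧ p.2 - q.2 ≤ 1) : starAdj p q := by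
  unfold starAdj
  have : p.1 ≠ q.1 ∨ p.2 ≠ q.2 := by
    by_contra hh
    push Not at hh
    exact hne (Prod.ext hh.1 hh.2)
  rcases abs_cases (p.1 - q.1) with h1 | h1 <;> rcases abs_cases (p.2 - q.2) with h2 | h2 <;>
    rcases max_cases |p.1 - q.1| |p.2 - q.2| with h3 | h3 <;> omega

theorem star_symm {p q : ℤ × ℤ} (h : starAdj p q) : starAdj q p := by
  unfold starAdj at *
  rwa [abs_sub_comm q.1, abs_sub_comm q.2]

theorem plus_symm {p q : ℤ × ℤ} (h : plusAdj p q) : plusAdj q p := by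
  unfold plusAdj at *
  rwa [abs_sub_comm q.1, abs_sub_comm q.2]

theorem plus_cases {a b : ℤ × ℤ} (h : plusAdj a b) :
    (a.1 = b.1 ∧ (b.2 = a.2 + 1 ∨ a.2 = b.2 + 1)) ∨
    (a.2 = b.2 ∧ (b.1 = a.1 + 1 ∨ a.1 = b.1 + 1)) := by
  unfold plusAdj at h
  rcases abs_cases (a.1 - b.1) with h1 | h1 <;> rcases abs_cases (a.2 - b.2) with h2 | h2 <;> omega

/-- Height indicator. -/
def hgt (p a : ℤ × ℤ) : ℤ := if p.2 < a.2 then 1 else 0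

/-- Signed crossing of the ray to the right of `p`. -/
def cr (p a b : ℤ × ℤ) : ℤ := if p.1 < a.1 then hgt p b - hgt p a else 0

theorem cr_anti {p a b : ℤ × ℤ} (h : plusAdj a b) : cr p b a = - cr p a b := by
  have := plus_cases h
  unfold cr hgt
  split_ifs <;> omega

/-- Plus graph on the set `B`. -/
def gr (B : Set (ℤ × ℤ)) : SimpleGraph (ℤ × ℤ) where
  Adj a b := plusAdj a b ∧ a ∈ B ∧ b ∈ B
  symm := ⟨fun _ _ h => ⟨plus_symm h.1, h.2.2, h.2.1⟩⟩
  loopless := ⟨fun a h => by simpa [plusAdj] using h.1⟩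

variable {B : Set (ℤ × ℤ)}

/-- Sum of `c` along a walk. -/
def wsum (c : ℤ × ℤ → ℤ × ℤ → ℤ) : {u v : ℤ × ℤ} → (gr B).Walk u v → ℤ
  | _, _, .nil => 0
  | _, _, .cons (u := u) (v := v) _ w => c u v + wsum c w

theorem wsum_append (c : ℤ × ℤ → ℤ × ℤ → ℤ) {u v x : ℤ × ℤ} (w : (gr B).Walk u v)
    (w' : (gr B).Walk v x) : wsum c (w.append w') = wsum c w + wsum c w' := by
  induction w with
  | nil => simp [wsum]
  | cons e w ih => simp [wsum, ih, add_assoc]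

theorem wsum_reverse (c : ℤ × ℤ → ℤ × ℤ → ℤ) (hc : ∀ a b, plusAdj a b → c b a = - c a b)
    {u v : ℤ × ℤ} (w : (gr B).Walk u v) : wsum c w.reverse = - wsum c w := by
  induction w with
  | nil => simp [wsum]
  | cons e w ih =>
    rw [SimpleGraph.Walk.reverse_cons, wsum_append, ih]
    simp [wsum, hc _ _ e.1]

theorem wsum_diff (c c' : ℤ × ℤ → ℤ × ℤ → ℤ) (g : ℤ × ℤ → ℤ) {u v : ℤ × ℤ}
    (w : (gr B).Walk u v)
    (h : ∀ a ∈ w.support, ∀ b ∈ w.support, plusAdj a b → c a b - c' a b = g b - g a) :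
    wsum c w - wsum c' w = g v - g u := by
  induction w with
  | nil => simp [wsum]
  | cons e w ih =>
    have h1 := ih (fun a ha b hb => h a (by simp [ha]) b (by simp [hb]))
    have h2 := h _ (by simp) _ (by simp) e.1
    simp only [wsum]
    linarith

theorem wsum_zero {u v : ℤ × ℤ} (w : (gr B).Walk u v) : wsum (fun _ _ => 0) w = 0 := by
  induction w with
  | nil => simp [wsum]
  | cons e w ih => simp [wsum, ih]

theorem support_sub {u v : ℤ × ℤ} (w : (gr B).Walk u v) (hu : u ∈ B) :
    ∀ x ∈ w.support, x ∈ B := by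
  induction w with
  | nil => simpa using hu
  | cons e w ih =>
    intro x hx
    rw [SimpleGraph.Walk.support_cons, List.mem_cons] at hx
    rcases hx with rfl | hx
    · exact hu
    · exact ih e.2.2 x hx

theorem wind_step_aux {p q u : ℤ × ℤ} (hpq : starAdj p q) (hle : p.2 ≤ q.2)
    (w : (gr B).Walk u u) (hp : p ∉ w.support) (hq : q ∉ w.support) :
    wsum (cr p) w = wsum (cr q) w := by
  have hs := star_cases hpq
  have hmem : ∀ a ∈ w.support, (a.1 ≠ p.1 ∨ a.2 ≠ p.2) ∧ (a.1 ≠ q.1 ∨ a.2 ≠ q.2) := by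
    intro a ha
    constructor
    · by_contra hh
      push Not at hh
      exact hp ((Prod.ext hh.1 hh.2 : a = p) ▸ ha)
    · by_contra hh
      push Not at hh
      exact hq ((Prod.ext hh.1 hh.2 : a = q) ▸ ha)
  have := wsum_diff (cr p) (cr q)
    (fun a => if p.2 < q.2 ∧ q.1 < a.1 ∧ a.2 = q.2 then 1 else 0) w (by
      intro a ha b hb hab
      have h1 := hmem a ha
      have h2 := hmem b hb
      have h3 := plus_cases hab
      unfold cr hgt
      split_ifs <;> omega)
  linarith

theorem wind_step {p q u : ℤ × ℤ} (hpq : starAdj p q)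
    (w : (gr B).Walk u u) (hp : p ∉ w.support) (hq : q ∉ w.support) :
    wsum (cr p) w = wsum (cr q) w := by
  rcases le_total p.2 q.2 with h | h
  · exact wind_step_aux hpq h w hp hq
  · exact (wind_step_aux (star_symm hpq) h w hq hp).symm

theorem reach_inv {A : Set (ℤ × ℤ)} (f : ℤ × ℤ → ℤ)
    (hf : ∀ p q, starAdj p q → p ∉ A → q ∉ A → f p = f q) {p q : ℤ × ℤ}
    (h : starReach A p q) : f p = f q := by
  obtain ⟨L, -, hch, hh, hl, hav⟩ := h
  induction L generalizing p with
  | nil => simp at hh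
  | cons a L ih =>
    simp at hh
    subst hh
    cases L with
    | nil => simp at hl; rw [hl]
    | cons b L =>
      have hch' := List.isChain_cons_cons.1 hch
      rw [hf a b hch'.1 (hav a (by simp)) (hav b (by simp))]
      refine ih hch'.2 rfl (by simpa using hl) (fun x hx => hav x (by simp [hx]))

theorem reach_extend {A : Set (ℤ × ℤ)} {p q r : ℤ × ℤ} (h : starReach A p q)
    (hqr : starAdj q r) (hr : r ∉ A) : starReach A p r := by
  obtain ⟨L, hnd, hch, hh, hl, hav⟩ := h
  by_cases hm : r ∈ L
  · obtain ⟨s, t, rfl⟩ := List.append_of_mem hm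
    have e : s ++ r :: t = (s ++ [r]) ++ t := by simp
    refine ⟨s ++ [r], ?_, ?_, ?_, by simp, ?_⟩
    · rw [e] at hnd
      exact (List.nodup_append.1 hnd).1
    · rw [e] at hch
      exact (List.isChain_append.1 hch).1
    · cases s <;> simpa using hh
    · intro x hx
      apply hav
      rw [e]
      exact List.mem_append_left _ hx
  · refine ⟨L ++ [r], ?_, ?_, ?_, by simp, ?_⟩
    · rw [List.nodup_append]
      refine ⟨hnd, by simp, ?_⟩
      intro a ha b hb hab
      simp at hb
      subst hb; subst hab
      exact hm ha
    · refine List.isChain_append.2 ⟨hch, by simp, ?_⟩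
      intro x hx y hy
      rw [hl] at hx
      simp at hx hy
      subst hx; subst hy
      exact hqr
    · cases L with
      | nil => simp at hh
      | cons a L => simpa using hh
    · intro x hx
      rcases List.mem_append.1 hx with hx | hx
      · exact hav x hx
      · simp at hx
        subst hx
        exact hr

theorem loop_erase (c : ℤ × ℤ → ℤ × ℤ → ℤ) {u v : ℤ × ℤ} (w : (gr B).Walk u v) :
    (∃ (x y : ℤ × ℤ) (e : (gr B).Adj x y) (p : (gr B).Walk y x), p.IsPath ∧
      wsum c (SimpleGraph.Walk.cons e p) ≠ 0) ∨
    ∃ p : (gr B).Walk u v, p.IsPath ∧ wsum c p = wsum c w := by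
  classical
  induction w with
  | nil => exact Or.inr ⟨.nil, by simp, rfl⟩
  | @cons u v z e w ih =>
    rcases ih with h | ⟨p, hp, hs⟩
    · exact Or.inl h
    · by_cases hu : u ∈ p.support
      · by_cases h0 : wsum c (SimpleGraph.Walk.cons e (p.takeUntil u hu)) = 0
        · refine Or.inr ⟨p.dropUntil u hu, hp.dropUntil hu, ?_⟩
          have h1 : wsum c (p.takeUntil u hu) + wsum c (p.dropUntil u hu) = wsum c p := by
            rw [← wsum_append, SimpleGraph.Walk.take_spec]
          simp only [wsum] at h0 ⊢
          linarith
        · exact Or.inl ⟨_, _, e, _, hp.takeUntil hu, h0⟩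
      · exact Or.inr ⟨.cons e p, hp.cons hu, by simp [wsum, hs]⟩

theorem exists_cycle (c : ℤ × ℤ → ℤ × ℤ → ℤ) {u : ℤ × ℤ} (w : (gr B).Walk u u)
    (hw : wsum c w ≠ 0) :
    ∃ (x y : ℤ × ℤ) (e : (gr B).Adj x y) (p : (gr B).Walk y x), p.IsPath ∧
      wsum c (SimpleGraph.Walk.cons e p) ≠ 0 := by
  rcases loop_erase c w with h | ⟨p, hp, hs⟩
  · exact h
  · have := SimpleGraph.Walk.isPath_iff_eq_nil.1 hp
    subst this
    simp [wsum] at hs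
    exact absurd hs.symm hw

theorem exists_potential (c : ℤ × ℤ → ℤ × ℤ → ℤ) (hc : ∀ a b, plusAdj a b → c b a = - c a b)
    (h : ∀ u (w : (gr B).Walk u u), wsum c w = 0) :
    ∃ f : ℤ × ℤ → ℤ, ∀ a b, (gr B).Adj a b → c a b = f b - f a := by
  have hr : ∀ v, (gr B).Reachable ((gr B).connectedComponentMk v).out v := fun v =>
    SimpleGraph.ConnectedComponent.exact (Quot.out_eq _)
  refine ⟨fun v => wsum c (hr v).some, fun a b hab => ?_⟩
  have key : ∀ (r r' : ℤ × ℤ) (_ : r = r') (w : (gr B).Walk r a) (w' : (gr B).Walk r' b),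
      c a b = wsum c w' - wsum c w := by
    rintro r _ rfl w w'
    have := h r (w.append (.cons hab w'.reverse))
    rw [wsum_append] at this
    simp only [wsum] at this
    rw [wsum_reverse c hc] at this
    linarith
  apply key
  rw [SimpleGraph.ConnectedComponent.sound hab.reachable]

theorem rect_zero (H V : ℤ → ℤ → ℤ)
    (hcl : ∀ x y, H x y + V (x + 1) y = V x y + H x (y + 1)) (x y : ℤ) (m n : ℕ) :
    (∑ i ∈ Finset.range m, H (x + i) y) + ∑ j ∈ Finset.range n, V (x + m) (y + j) =
    (∑ j ∈ Finset.range n, V x (y + j)) + ∑ i ∈ Finset.range m, H (x + i) (y + n) := by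
  have row : ∀ y, (∑ i ∈ Finset.range m, H (x + i) y) + V (x + m) y =
      V x y + ∑ i ∈ Finset.range m, H (x + i) (y + 1) := by
    intro y
    induction m with
    | zero => simp
    | succ m ih =>
      rw [Finset.sum_range_succ, Finset.sum_range_succ]
      have := hcl (x + m) y
      push_cast
      rw [← add_assoc x]
      linarith
  induction n with
  | zero => simp
  | succ n ih =>
    rw [Finset.sum_range_succ, Finset.sum_range_succ]
    have := row (y + n)
    push_cast
    rw [← add_assoc y]
    linarith

/-- The closed walk with nonzero winding number in the boundary of `C`. -/
theorem exists_walk (C : Set (ℤ × ℤ)) (h0 : ((0, 0) : ℤ × ℤ) ∈ C) (hfin : C.Finite)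
    (hB : ∀ x, x ∉ C → (∃ c ∈ C, starAdj x c) → x ∈ B)
    (hB' : ∀ x ∈ B, ∃ c ∈ C, starAdj x c) :
    ∃ (u : ℤ × ℤ) (w : (gr B).Walk u u), wsum (cr (0, 0)) w ≠ 0 := by
  classical
  by_contra hno
  push Not at hno
  obtain ⟨f, hf⟩ := exists_potential (cr (0, 0)) (fun a b => cr_anti) hno
  obtain ⟨M, hM⟩ : ∃ M : ℕ, ∀ c ∈ C, |c.1| ≤ M ∧ |c.2| ≤ M := by
    obtain ⟨M, hM⟩ := (hfin.image (fun c => max c.1.natAbs c.2.natAbs)).bddAbove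
    refine ⟨M, fun c hc => ?_⟩
    have := hM ⟨c, hc, rfl⟩
    simp only [max_le_iff] at this
    simp only [abs_le]
    omega
  let ft : ℤ × ℤ → ℤ := fun a => if a ∈ B then f a else 0
  let e : ℤ × ℤ → ℤ × ℤ → ℤ := fun a b =>
    if a ∈ C ∨ b ∈ C then 0 else cr (0, 0) a b - (ft b - ft a)
  have hez : ∀ a b z, z ∈ C → plusAdj a b →
      (-1 ≤ a.1 - z.1 ∧ a.1 - z.1 ≤ 1 ∧ -1 ≤ a.2 - z.2 ∧ a.2 - z.2 ≤ 1) →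
      (-1 ≤ b.1 - z.1 ∧ b.1 - z.1 ≤ 1 ∧ -1 ≤ b.2 - z.2 ∧ b.2 - z.2 ≤ 1) → e a b = 0 := by
    intro a b z hz hab ha hb
    by_cases hC : a ∈ C ∨ b ∈ C
    · simp only [e, if_pos hC]
    · simp only [e, if_neg hC]
      push Not at hC
      have haB : a ∈ B := hB a hC.1 ⟨z, hz, star_of (fun h => hC.1 (h ▸ hz)) ha⟩
      have hbB : b ∈ B := hB b hC.2 ⟨z, hz, star_of (fun h => hC.2 (h ▸ hz)) hb⟩
      simp only [ft, if_pos haB, if_pos hbB, hf a b ⟨hab, haB, hbB⟩, sub_self]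
  have hpr : ∀ x y : ℤ, plusAdj (x, y) (x + 1, y) := by
    intro x y; simp [plusAdj]
  have hpu : ∀ x y : ℤ, plusAdj (x, y) (x, y + 1) := by
    intro x y; simp [plusAdj]
  have hcl : ∀ x y : ℤ, e (x, y) (x + 1, y) + e (x + 1, y) (x + 1, y + 1) =
      e (x, y) (x, y + 1) + e (x, y + 1) (x + 1, y + 1) := by
    intro x y
    by_cases hz : ∃ z ∈ C, (z.1 = x ∨ z.1 = x + 1) ∧ (z.2 = y ∨ z.2 = y + 1)
    · obtain ⟨z, hz, hzz⟩ := hz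
      rw [hez _ _ z hz (hpr _ _), hez _ _ z hz (hpu _ _), hez _ _ z hz (hpu _ _),
        hez _ _ z hz (hpr _ _)]
      all_goals (dsimp only; omega)
    · push Not at hz
      have k1 : (x, y) ∉ C := fun h => (hz _ h (by simp)).1 rfl
      have k2 : (x + 1, y) ∉ C := fun h => (hz _ h (by simp)).1 rfl
      have k3 : (x, y + 1) ∉ C := fun h => (hz _ h (by simp)).2 rfl
      have k4 : (x + 1, y + 1) ∉ C := fun h => (hz _ h (by simp)).2 rfl
      have k0 : ¬ (x = 0 ∧ y = 0) := by
        rintro ⟨rfl, rfl⟩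
        exact k1 h0
      simp only [e, k1, k2, k3, k4, or_self, if_false]
      unfold cr hgt
      dsimp only
      split_ifs <;> omega
  have hfar : ∀ a b : ℤ × ℤ, ((M : ℤ) + 2 ≤ |a.1| ∨ (M : ℤ) + 2 ≤ |a.2|) →
      ((M : ℤ) + 2 ≤ |b.1| ∨ (M : ℤ) + 2 ≤ |b.2|) → e a b = cr (0, 0) a b := by
    have hh : ∀ a : ℤ × ℤ, ((M : ℤ) + 2 ≤ |a.1| ∨ (M : ℤ) + 2 ≤ |a.2|) → a ∉ C ∧ a ∉ B := by
      intro a ha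
      constructor
      · intro hC
        have := hM a hC
        omega
      · intro hC
        obtain ⟨c, hc, hac⟩ := hB' a hC
        have h1 := hM c hc
        have h2 := star_cases hac
        simp only [abs_le, le_abs] at *
        omega
    intro a b ha hb
    simp [e, ft, hh a ha, hh b hb]
  have key := rect_zero (fun x y => e (x, y) (x + 1, y)) (fun x y => e (x, y) (x, y + 1)) hcl
    (-(M + 2)) (-(M + 2)) (2 * (M + 2)) (2 * (M + 2))
  have s1 : ∀ i : ℕ, e (-((M : ℤ) + 2) + i, -((M : ℤ) + 2)) (-((M : ℤ) + 2) + i + 1, -((M : ℤ) + 2)) = 0 := by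
    intro i
    rw [hfar _ _ (by dsimp only; simp only [le_abs]; omega) (by dsimp only; simp only [le_abs]; omega)]
    unfold cr hgt
    dsimp only
    split_ifs <;> omega
  have s2 : ∀ i : ℕ, e (-((M : ℤ) + 2) + i, -((M : ℤ) + 2) + (2 * (M + 2) : ℕ))
      (-((M : ℤ) + 2) + i + 1, -((M : ℤ) + 2) + (2 * (M + 2) : ℕ)) = 0 := by
    intro i
    rw [hfar _ _ (by dsimp only; simp only [le_abs]; omega) (by dsimp only; simp only [le_abs]; omega)]
    unfold cr hgt
    dsimp only
    split_ifs <;> omega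
  have s3 : ∀ j : ℕ, e (-((M : ℤ) + 2), -((M : ℤ) + 2) + j) (-((M : ℤ) + 2), -((M : ℤ) + 2) + j + 1) = 0 := by
    intro i
    rw [hfar _ _ (by dsimp only; simp only [le_abs]; omega) (by dsimp only; simp only [le_abs]; omega)]
    unfold cr hgt
    dsimp only
    split_ifs <;> omega
  have s4 : ∀ j : ℕ, e (-((M : ℤ) + 2) + (2 * (M + 2) : ℕ), -((M : ℤ) + 2) + j)
      (-((M : ℤ) + 2) + (2 * (M + 2) : ℕ), -((M : ℤ) + 2) + j + 1) = if j = M + 2 then 1 else 0 := by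
    intro i
    rw [hfar _ _ (by dsimp only; simp only [le_abs]; omega) (by dsimp only; simp only [le_abs]; omega)]
    unfold cr hgt
    dsimp only
    split_ifs <;> omega
  simp only [s1, s2, s3, s4] at key
  simp at key

theorem wind_far {u : ℤ × ℤ} (w : (gr B).Walk u u) :
    ∃ N : ℕ, ∀ k, wsum (cr k) w ≠ 0 → |k.1| ≤ N ∧ |k.2| ≤ N := by
  obtain ⟨N, hN⟩ : ∃ N : ℕ, ∀ c ∈ w.support, c.1.natAbs ≤ N ∧ c.2.natAbs ≤ N := by
    obtain ⟨M, hM⟩ := ((w.support.finite_toSet).image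
      (fun c : ℤ × ℤ => max c.1.natAbs c.2.natAbs)).bddAbove
    refine ⟨M, fun c hc => ?_⟩
    have := hM ⟨c, hc, rfl⟩
    simpa only [max_le_iff] using this
  refine ⟨N + 1, fun k hk => ?_⟩
  by_contra hcon
  simp only [abs_le] at hcon
  push_cast at hcon
  apply hk
  have := wsum_diff (cr k) (fun _ _ => 0) (fun a => if k.1 < - N then hgt k a else 0) w (by
    intro a ha b hb hab
    have h1 := hN a ha
    have h2 := hN b hb
    have h3 := plus_cases hab
    unfold cr hgt
    split_ifs <;> omega)
  rw [wsum_zero] at this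
  linarith

end PlusCycleAux

open PlusCycleAux

/-- If `S₀` is occupied and `C(0)` is finite, there is a plus connected S-cycle of
vacant squares, each star adjacent to some square of `C(0)`, whose square set
surrounds every square of `C(0)`. -/
theorem exists_vacant_plus_cycle_surrounding
    (ω : ℤ × ℤ → Bool) (h0 : ω (0, 0) = true) (hfin : (C0 ω).Finite) :
    ∃ V : List (ℤ × ℤ), IsPlusCycle V ∧
      (∀ v ∈ V, ω v = false ∧ ∃ c ∈ C0 ω, starAdj v c) ∧
      (∀ c ∈ C0 ω, surrounds {x | x ∈ V} c) := by
  have hz : ((0, 0) : ℤ × ℤ) ∈ C0 ω :=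
    ⟨h0, [(0, 0)], by simp, List.isChain_singleton _, rfl, rfl, by simp [h0]⟩
  obtain ⟨u, w, hw⟩ := exists_walk (B := {v | ω v = false ∧ ∃ c ∈ C0 ω, starAdj v c}) (C0 ω) hz
    hfin (by
      rintro x hx ⟨c, hc, hxc⟩
      refine ⟨?_, c, hc, hxc⟩
      by_contra hne
      have hx1 : ω x = true := by simpa using hne
      exact hx ⟨hx1, reach_extend hc.2 (star_symm hxc) (by simp [hx1])⟩) (fun x hx => hx.2)
  obtain ⟨x, y, e, p, hp, hs⟩ := exists_cycle _ w hw
  have hB := support_sub p e.2.2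
  have hsup : ∀ z, z ∈ (SimpleGraph.Walk.cons e p).support ↔ z ∈ p.support := by
    intro z
    rw [SimpleGraph.Walk.support_cons, List.mem_cons]
    constructor
    · rintro (rfl | h)
      · exact p.end_mem_support
      · exact h
    · exact Or.inr
  have hvac : ∀ c ∈ C0 ω, c ∉ p.support := by
    intro c hc h
    have h1 := (hB c h).1
    rw [hc.1] at h1
    cases h1
  refine ⟨p.support, ⟨p.support_ne_nil, hp.support_nodup, ?_, y, x, ?_, ?_, e.1⟩, hB, ?_⟩
  · exact List.IsChain.imp (fun a b h => h.1) p.isChain_adj_support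
  · rw [List.head?_eq_some_head p.support_ne_nil, SimpleGraph.Walk.head_support]
  · rw [List.getLast?_eq_some_getLast p.support_ne_nil, SimpleGraph.Walk.getLast_support]
  · intro c hc
    refine ⟨hvac c hc, ?_⟩
    obtain ⟨N, hN⟩ := wind_far (SimpleGraph.Walk.cons e p)
    refine Set.Finite.subset (Set.finite_Icc ((-(N : ℤ), -(N : ℤ)) : ℤ × ℤ) ((N : ℤ), (N : ℤ))) ?_
    intro k hk
    have i1 := reach_inv (A := {x | ω x = false})
      (fun q => wsum (cr q) (SimpleGraph.Walk.cons e p))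
      (fun a b hab ha hb => wind_step hab _
        (fun h => ha (hB a ((hsup a).1 h)).1) (fun h => hb (hB b ((hsup b).1 h)).1)) hc.2
    have i2 := reach_inv (fun q => wsum (cr q) (SimpleGraph.Walk.cons e p))
      (fun a b hab ha hb => wind_step hab _
        (fun h => ha ((hsup a).1 h)) (fun h => hb ((hsup b).1 h))) hk
    have := hN k (by rw [← i2, ← i1]; exact hs)
    simp only [abs_le] at this
    exact ⟨⟨this.1.1, this.2.1⟩, ⟨this.1.2, this.2.2⟩⟩
end

section
/- Suppose the square S₀ is occupied and the component C(0) is finite. Then there exists a plus connected S-cycle (V₁,…,V_s) such that: every square V_i is vacant and star adjacent to some square of C(0); the set {V₁,…,V_s} surrounds every square of C(0); and every vacant square that is star adjacent to some square of C(0) and does not belong to {V₁,…,V_s} is surrounded by {V₁,…,V_s}. -/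
/-- Sum of `φ` over consecutive pairs of a list. -/
def wsum (φ : ℤ × ℤ → ℤ × ℤ → ℤ) : List (ℤ × ℤ) → ℤ
  | [] => 0
  | [_] => 0
  | a :: b :: l => φ a b + wsum φ (b :: l)

def clo (V : List (ℤ × ℤ)) : List (ℤ × ℤ) := V ++ V.head?.toList

def csum (φ : ℤ × ℤ → ℤ × ℤ → ℤ) (V : List (ℤ × ℤ)) : ℤ := wsum φ (clo V)

def Cyc (V : List (ℤ × ℤ)) : Prop := 3 ≤ V.length ∧ V.Nodup ∧ (clo V).IsChain plusAdj

def edl (u v x y : ℤ × ℤ) : ℤ :=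
  (if x = u ∧ y = v then 1 else 0) - (if x = v ∧ y = u then 1 else 0)

def crs (f u v : ℤ × ℤ) : ℤ :=
  if f.1 < u.1 ∧ v.1 = u.1 then
    (if u.2 = f.2 ∧ v.2 = f.2 + 1 then 1 else 0) - (if v.2 = f.2 ∧ u.2 = f.2 + 1 then 1 else 0)
  else 0

def wnd (V : List (ℤ × ℤ)) (f : ℤ × ℤ) : ℤ := csum (crs f) V

def enet (V : List (ℤ × ℤ)) (u v : ℤ × ℤ) : ℤ := csum (edl u v) V

/-- the face on the left of the directed edge `u → v`. -/
def lface (u v : ℤ × ℤ) : ℤ × ℤ :=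
  ((u.1 + v.1 - (v.2 - u.2) - 1) / 2, (u.2 + v.2 + (v.1 - u.1) - 1) / 2)

theorem plusAdj_iff (u v : ℤ × ℤ) : plusAdj u v ↔
    (v.1 = u.1 + 1 ∧ v.2 = u.2) ∨ (v.1 = u.1 - 1 ∧ v.2 = u.2) ∨
    (v.1 = u.1 ∧ v.2 = u.2 + 1) ∨ (v.1 = u.1 ∧ v.2 = u.2 - 1) := by
  unfold plusAdj
  rcases abs_cases (u.1 - v.1) with h | h <;> rcases abs_cases (u.2 - v.2) with h' | h' <;> omega

theorem starAdj_iff (u v : ℤ × ℤ) : starAdj u v ↔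
    (v.1 ≤ u.1 + 1 ∧ u.1 ≤ v.1 + 1 ∧ v.2 ≤ u.2 + 1 ∧ u.2 ≤ v.2 + 1) ∧ ¬ (u.1 = v.1 ∧ u.2 = v.2) := by
  unfold starAdj
  rcases abs_cases (u.1 - v.1) with h | h <;> rcases abs_cases (u.2 - v.2) with h' | h' <;> omega

theorem plusAdj_symm {u v : ℤ × ℤ} (h : plusAdj u v) : plusAdj v u := by
  rw [plusAdj_iff] at *; omega

theorem wsum_append (φ) (X : List (ℤ × ℤ)) (p : ℤ × ℤ) (Y : List (ℤ × ℤ)) :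
    wsum φ (X ++ p :: Y) = wsum φ (X ++ [p]) + wsum φ (p :: Y) := by
  induction X with
  | nil => simp [wsum]
  | cons a X ih =>
    cases X with
    | nil => simp [wsum]
    | cons b X => simp only [List.cons_append, wsum] at *; rw [ih]; ring

theorem wsum_reverse (φ) (hφ : ∀ x y, φ x y = - φ y x) (X : List (ℤ × ℤ)) :
    wsum φ X.reverse = - wsum φ X := by
  induction X with
  | nil => simp [wsum]
  | cons a X ih =>
    cases X with
    | nil => simp [wsum]
    | cons b X =>
      simp only [List.reverse_cons, List.append_assoc, List.cons_append, List.nil_append] at *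
      rw [wsum_append, ih]
      simp only [wsum]
      rw [hφ a b]; ring

theorem wsum_add (φ ψ) (X : List (ℤ × ℤ)) :
    wsum (fun x y => φ x y + ψ x y) X = wsum φ X + wsum ψ X := by
  induction X with
  | nil => simp [wsum]
  | cons a X ih =>
    cases X with
    | nil => simp [wsum]
    | cons b X => simp only [wsum] at *; rw [ih]; ring

theorem wsum_congr (φ ψ) (X : List (ℤ × ℤ)) (hX : X.IsChain plusAdj)
    (h : ∀ x ∈ X, ∀ y ∈ X, plusAdj x y → φ x y = ψ x y) : wsum φ X = wsum ψ X := by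
  induction X with
  | nil => simp [wsum]
  | cons a X ih =>
    cases X with
    | nil => simp [wsum]
    | cons b X =>
      simp only [wsum] at *
      rw [List.isChain_cons_cons] at hX
      rw [ih hX.2 (fun x hx y hy => h x (List.mem_cons_of_mem _ hx) y (List.mem_cons_of_mem _ hy)),
        h a (by simp) b (by simp) hX.1]

theorem wsum_zero (φ) (X : List (ℤ × ℤ))
    (h : ∀ x ∈ X, ∀ y ∈ X, φ x y = 0) : wsum φ X = 0 := by
  induction X with
  | nil => simp [wsum]
  | cons a X ih =>
    cases X with
    | nil => simp [wsum]
    | cons b X =>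
      simp only [wsum] at *
      rw [ih (fun x hx y hy => h x (List.mem_cons_of_mem _ hx) y (List.mem_cons_of_mem _ hy)),
        h a (by simp) b (by simp), add_zero]

/-- telescoping -/
theorem wsum_tele (γ : ℤ × ℤ → ℤ) (X : List (ℤ × ℤ)) (a b : ℤ × ℤ) :
    wsum (fun x y => γ y - γ x) (a :: X ++ [b]) = γ b - γ a := by
  induction X generalizing a with
  | nil => simp [wsum]
  | cons c X ih =>
    simp only [List.cons_append, wsum] at *
    rw [ih]; ring

theorem clo_cons (a) (l : List (ℤ × ℤ)) : clo (a :: l) = a :: l ++ [a] := by simp [clo]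

theorem mem_clo {V : List (ℤ × ℤ)} {x} : x ∈ clo V ↔ x ∈ V := by
  cases V <;> simp [clo]
  tauto

theorem csum_two (φ) (p X q Y) : csum φ (p :: X ++ q :: Y) =
    wsum φ (p :: X ++ [q]) + wsum φ (q :: Y ++ [p]) := by
  unfold csum
  rw [List.cons_append, clo_cons]
  have : p :: (X ++ q :: Y) ++ [p] = (p :: X) ++ q :: (Y ++ [p]) := by simp
  rw [this, wsum_append]
  simp

theorem chain_two (p X q Y) : (clo (p :: X ++ q :: Y)).IsChain plusAdj ↔
    (p :: X ++ [q]).IsChain plusAdj ∧ (q :: Y ++ [p]).IsChain plusAdj := by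
  rw [List.cons_append, clo_cons]
  have : p :: (X ++ q :: Y) ++ [p] = (p :: X) ++ q :: (Y ++ [p]) := by simp
  rw [this, List.isChain_split]
  simp

/-- Two lists giving the same cycle. -/
def Eqv (V V' : List (ℤ × ℤ)) : Prop :=
  (∀ x, x ∈ V ↔ x ∈ V') ∧ (∀ φ, csum φ V = csum φ V')

theorem rot_split (p X q Y) (h : Cyc (p :: X ++ q :: Y)) :
    Cyc (q :: Y ++ p :: X) ∧ Eqv (p :: X ++ q :: Y) (q :: Y ++ p :: X) := by
  obtain ⟨h1, h2, h3⟩ := h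
  refine ⟨⟨?_, ?_, ?_⟩, ?_, ?_⟩
  · simp at *; omega
  · exact (List.perm_append_comm.nodup_iff).1 h2
  · rw [chain_two] at *; exact h3.symm
  · intro x; simp; tauto
  · intro φ; rw [csum_two, csum_two, add_comm]

theorem rot_head {V : List (ℤ × ℤ)} (h : Cyc V) {v} (hv : v ∈ V) :
    ∃ l, Cyc (v :: l) ∧ Eqv V (v :: l) := by
  obtain ⟨X, Y, rfl⟩ := List.append_of_mem hv
  cases X with
  | nil => exact ⟨Y, h, by simp [Eqv]⟩
  | cons a X => exact ⟨_, rot_split _ _ _ _ h⟩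

theorem Eqv.trans {U V W : List (ℤ × ℤ)} (h : Eqv U V) (h' : Eqv V W) : Eqv U W :=
  ⟨fun x => (h.1 x).trans (h'.1 x), fun φ => (h.2 φ).trans (h'.2 φ)⟩

theorem rot_mid {V : List (ℤ × ℤ)} (h : Cyc V) {v} (hv : v ∈ V) :
    ∃ u x l, Cyc (u :: v :: x :: l) ∧ Eqv V (u :: v :: x :: l) := by
  obtain ⟨l, hl, he⟩ := rot_head h hv
  have hlen := hl.1
  rcases l with _ | ⟨x, l⟩
  · simp at hlen
  rcases List.eq_nil_or_concat l with rfl | ⟨l', u, rfl⟩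
  · simp at hlen
  have hl' : Cyc (v :: (x :: l') ++ u :: []) := by simpa using hl
  have := rot_split _ _ _ _ hl'
  refine ⟨u, x, l', by simpa using this.1, he.trans (by simpa using this.2)⟩

theorem edl_anti (u v x y) : edl u v x y = - edl u v y x := by unfold edl; grind
theorem edl_anti' (u v x y) : edl u v x y = - edl v u x y := by unfold edl; grind
theorem crs_anti (f x y) : crs f x y = - crs f y x := by unfold crs; grind

theorem wsum_neg (φ) (X : List (ℤ × ℤ)) :
    wsum (fun x y => - φ x y) X = - wsum φ X := by
  induction X with
  | nil => simp [wsum]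
  | cons a X ih =>
    cases X with
    | nil => simp [wsum]
    | cons b X => simp only [wsum] at *; rw [ih]; ring

theorem enet_anti (V u v) : enet V u v = - enet V v u := by
  unfold enet csum
  rw [← wsum_neg]
  congr 1; funext x y; exact edl_anti' _ _ _ _

theorem enet_not_mem {V v} (h : v ∉ V) (y) : enet V v y = 0 := by
  unfold enet csum
  apply wsum_zero
  intro a ha b hb
  rw [mem_clo] at ha hb
  unfold edl; grind

theorem enet_mid {u v x l} (h : Cyc (u :: v :: x :: l)) (y) :
    enet (u :: v :: x :: l) v y = (if y = x then 1 else 0) - (if y = u then 1 else 0) := by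
  have hn := h.2.1
  unfold enet csum
  rw [clo_cons]
  simp only [List.cons_append, wsum]
  rw [wsum_zero (edl v y) (x :: (l ++ [u]))]
  · unfold edl; simp at hn; grind
  · intro a ha b hb
    unfold edl; simp at hn ha hb; grind

theorem crs_sub_h (a b : ℤ) (x y) : crs (a-1,b) x y = crs (a,b) x y + edl (a,b) (a,b+1) x y := by
  obtain ⟨x1, x2⟩ := x
  obtain ⟨y1, y2⟩ := y
  unfold crs edl
  simp only [Prod.mk.injEq]
  split_ifs <;> omega

theorem crs_sub_v (a b : ℤ) (x y) (h : plusAdj x y) : crs (a,b) x y = crs (a,b-1) x y +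
    (edl (a,b) (a+1,b) x y + ((fun z : ℤ × ℤ => if a < z.1 ∧ z.2 = b then (-1:ℤ) else 0) y -
      (fun z : ℤ × ℤ => if a < z.1 ∧ z.2 = b then (-1:ℤ) else 0) x)) := by
  rw [plusAdj_iff] at h
  obtain ⟨x1, x2⟩ := x
  obtain ⟨y1, y2⟩ := y
  unfold crs edl
  simp only [Prod.mk.injEq] at *
  rcases h with h | h | h | h <;> obtain ⟨rfl, rfl⟩ := h <;> split_ifs <;> omega

theorem wnd_h (V) (a b : ℤ) : wnd V (a-1,b) = wnd V (a,b) + enet V (a,b) (a,b+1) := by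
  unfold wnd enet csum
  rw [← wsum_add]
  congr 1; funext x y; exact crs_sub_h _ _ _ _

theorem wnd_v {V} (hV : Cyc V) (a b : ℤ) : wnd V (a,b) = wnd V (a,b-1) + enet V (a,b) (a+1,b) := by
  unfold wnd enet csum
  rw [wsum_congr _ _ _ hV.2.2 (fun x _ y _ h => crs_sub_v a b x y h), wsum_add, wsum_add]
  cases V with
  | nil => have := hV.1; simp at this
  | cons c l => rw [clo_cons, wsum_tele]; ring

theorem flux {V} (hV : Cyc V) {u v} (h : plusAdj u v) :
    wnd V (lface u v) = wnd V (lface v u) + enet V u v := by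
  rw [plusAdj_iff] at h
  obtain ⟨x1, x2⟩ := u
  obtain ⟨y1, y2⟩ := v
  simp only at h
  rcases h with h | h | h | h <;> obtain ⟨h1, h2⟩ := h <;> rw [h1, h2]
  · have e1 : lface (x1, x2) (x1+1, x2) = (x1, x2) := by
      unfold lface; ext <;> simp only <;> omega
    have e2 : lface (x1+1, x2) (x1, x2) = (x1, x2-1) := by
      unfold lface; ext <;> simp only <;> omega
    rw [e1, e2]; exact wnd_v hV _ _
  · have e1 : lface (x1, x2) (x1-1, x2) = (x1-1, x2-1) := by
      unfold lface; ext <;> simp only <;> omega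
    have e2 : lface (x1-1, x2) (x1, x2) = (x1-1, x2) := by
      unfold lface; ext <;> simp only <;> omega
    rw [e1, e2, enet_anti]
    have := wnd_v hV (x1-1) x2
    simp only [sub_add_cancel] at this
    omega
  · have e1 : lface (x1, x2) (x1, x2+1) = (x1-1, x2) := by
      unfold lface; ext <;> simp only <;> omega
    have e2 : lface (x1, x2+1) (x1, x2) = (x1, x2) := by
      unfold lface; ext <;> simp only <;> omega
    rw [e1, e2]; exact wnd_h V _ _
  · have e1 : lface (x1, x2) (x1, x2-1) = (x1, x2-1) := by
      unfold lface; ext <;> simp only <;> omega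
    have e2 : lface (x1, x2-1) (x1, x2) = (x1-1, x2-1) := by
      unfold lface; ext <;> simp only <;> omega
    rw [e1, e2, enet_anti]
    have := wnd_h V x1 (x2-1)
    simp only [sub_add_cancel] at this
    omega

def fval (W : ℤ × ℤ → ℤ) : List (ℤ × ℤ) → ℤ
  | u :: v :: _ => W (lface u v)
  | _ => 0

theorem Eqv.wnd_eq {U V : List (ℤ × ℤ)} (h : Eqv U V) : wnd U = wnd V := by
  funext f; exact h.2 _

theorem Eqv.enet_eq {U V : List (ℤ × ℤ)} (h : Eqv U V) (u v) : enet U u v = enet V u v := h.2 _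

theorem Eqv.symm {U V : List (ℤ × ℤ)} (h : Eqv U V) : Eqv V U :=
  ⟨fun x => (h.1 x).symm, fun φ => (h.2 φ).symm⟩

theorem turn_cases {u v x : ℤ × ℤ} (h1 : plusAdj u v) (h2 : plusAdj v x) (h3 : u ≠ x) :
    lface u v = lface v x ∨ lface v u = lface x v ∨
    ∃ y, plusAdj v y ∧ y ≠ u ∧ y ≠ x ∧ lface v y = lface u v ∧ lface y v = lface v x := by
  obtain ⟨u1, u2⟩ := u
  obtain ⟨v1, v2⟩ := v
  obtain ⟨x1, x2⟩ := x
  rw [plusAdj_iff] at h1 h2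
  simp only [ne_eq, Prod.mk.injEq] at h1 h2 h3
  have key : (lface (u1,u2) (v1,v2) = lface (v1,v2) (x1,x2)) ∨
      (lface (v1,v2) (u1,u2) = lface (x1,x2) (v1,v2)) ∨ (x1 - v1 = v1 - u1 ∧ x2 - v2 = v2 - u2) := by
    simp only [lface, Prod.mk.injEq]
    rcases h1 with h1 | h1 | h1 | h1 <;> rcases h2 with h2 | h2 | h2 | h2 <;>
      first
      | (exfalso; omega)
      | (right; right; omega)
      | (left; omega)
      | (right; left; omega)
  rcases key with h | h | h
  · exact Or.inl h
  · exact Or.inr (Or.inl h)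
  · refine Or.inr (Or.inr ⟨(v1 - (v2 - u2), v2 + (v1 - u1)), ?_⟩)
    rw [plusAdj_iff]
    simp only [lface, Prod.mk.injEq, ne_eq]
    rcases h1 with h1 | h1 | h1 | h1 <;> refine ⟨?_, ?_, ?_, ?_, ?_⟩ <;> omega

theorem cyc_adj {u v l} (h : Cyc (u :: v :: l)) : plusAdj u v := by
  have := h.2.2
  rw [clo_cons] at this
  simp only [List.cons_append, List.isChain_cons_cons] at this
  exact this.1

theorem enet_first {p z l} (h : Cyc (p :: z :: l)) : enet (p :: z :: l) p z = 1 := by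
  have hl := h.1
  have hn := h.2.1
  rcases l with _ | ⟨x, l⟩
  · simp at hl
  rw [enet_anti, enet_mid h, if_neg, if_pos rfl]
  · simp
  · rintro rfl; simp at hn

theorem turn {u v x l} (h : Cyc (u :: v :: x :: l)) :
    wnd (u :: v :: x :: l) (lface u v) = wnd (u :: v :: x :: l) (lface v x) := by
  have a1 := cyc_adj h
  have a2 : plusAdj v x := by
    have := h.2.2
    rw [clo_cons] at this
    simp only [List.cons_append, List.isChain_cons_cons] at this
    exact this.2.1
  have hn := h.2.1
  have hux : u ≠ x := by rintro rfl; simp at hn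
  have e1 := enet_first h
  have e2 := enet_mid h x
  rw [if_pos rfl, if_neg (Ne.symm hux)] at e2
  have f1 := flux h a1
  have f2 := flux h a2
  rcases turn_cases a1 a2 hux with h' | h' | ⟨y, hy, hu, hx, h1, h2⟩
  · rw [h']
  · rw [f1, f2, e1, e2, h']; ring
  · have f3 := flux h hy
    rw [enet_mid h, if_neg hx, if_neg hu, h1, h2] at f3
    rw [f3]; ring

theorem rot_one {V : List (ℤ × ℤ)} (h : Cyc V) : Cyc (V.rotate 1) ∧ Eqv V (V.rotate 1) ∧
    fval (wnd V) (V.rotate 1) = fval (wnd V) V := by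
  have hl := h.1
  rcases V with _ | ⟨u, _ | ⟨v, _ | ⟨x, l⟩⟩⟩
  · simp at hl
  · simp at hl
  · simp at hl
  have := rot_split u [] v (x :: l) (by simpa using h)
  refine ⟨by simpa using this.1, by simpa using this.2, ?_⟩
  simp only [List.rotate_cons_succ, List.rotate_zero, List.cons_append, fval]
  exact (turn h).symm

theorem rot_n {V : List (ℤ × ℤ)} (h : Cyc V) (n : ℕ) : Cyc (V.rotate n) ∧ Eqv V (V.rotate n) ∧
    fval (wnd V) (V.rotate n) = fval (wnd V) V := by
  induction n with
  | zero => simp [h, Eqv]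
  | succ n ih =>
    obtain ⟨h1, h2, h3⟩ := ih
    obtain ⟨g1, g2, g3⟩ := rot_one h1
    rw [List.rotate_rotate] at g1 g2 g3
    refine ⟨g1, h2.trans g2, ?_⟩
    rw [← h2.wnd_eq] at g3
    rw [g3, h3]

theorem edge_next {V : List (ℤ × ℤ)} (h : Cyc V) {u} (hu : u ∈ V) :
    ∃ v, v ≠ u ∧ enet V u v = 1 ∧ (∀ y, y ≠ v → enet V u y ≤ 0) ∧ (∀ y, -1 ≤ enet V u y) ∧
      plusAdj u v ∧ wnd V (lface u v) = fval (wnd V) V := by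
  obtain ⟨X, Y, rfl⟩ := List.append_of_mem hu
  obtain ⟨h1, h2, h3⟩ := rot_n h X.length
  rw [List.rotate_append_length_eq] at h1 h2 h3
  obtain ⟨a, x, l, c1, c2⟩ := rot_mid h hu
  have hn := c1.2.1
  have hl := h1.1
  have ex := enet_mid c1
  rw [List.cons_append] at h1 h2 h3 hl
  rcases hr : Y ++ X with _ | ⟨v, r⟩
  · rw [hr] at hl; simp at hl
  rw [hr] at h1 h2 h3
  have e1 := enet_first h1
  rw [← h2.enet_eq] at e1
  have hvx : v = x := by
    by_contra hne
    have := ex v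
    rw [← c2.enet_eq, e1, if_neg hne] at this
    split_ifs at this <;> omega
  refine ⟨v, ?_, e1, ?_, ?_, cyc_adj h1, h3⟩
  · rintro rfl
    have := h1.2.1
    simp at this
  · intro y hy
    rw [c2.enet_eq, ex, if_neg (by rw [← hvx]; exact hy)]
    split_ifs <;> simp
  · intro y
    rw [c2.enet_eq, ex]
    split_ifs <;> simp

theorem enet_range {V : List (ℤ × ℤ)} (h : Cyc V) (u v) :
    enet V u v = 0 ∨ enet V u v = 1 ∨ enet V u v = -1 := by
  by_cases hu : u ∈ V
  · obtain ⟨x, -, h1, h2, h3, -⟩ := edge_next h hu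
    have := h3 v
    by_cases hv : v = x
    · subst hv; omega
    · have := h2 v hv; omega
  · left; exact enet_not_mem hu _

theorem edge_val {V : List (ℤ × ℤ)} (h : Cyc V) {u v} (he : enet V u v = 1) :
    plusAdj u v ∧ wnd V (lface u v) = fval (wnd V) V ∧
      wnd V (lface v u) = fval (wnd V) V - 1 := by
  have hu : u ∈ V := by
    by_contra hu
    rw [enet_not_mem hu] at he; omega
  obtain ⟨x, -, h1, h2, h3, h4, h5⟩ := edge_next h hu
  have hv : v = x := by
    by_contra hv
    have := h2 v hv; omega
  subst hv
  have := flux h h4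
  refine ⟨h4, h5, by omega⟩

theorem bdd (V : List (ℤ × ℤ)) : ∃ M : ℤ, ∀ v ∈ V, v.1 < M ∧ v.2 < M ∧ -M < v.1 ∧ -M < v.2 := by
  induction V with
  | nil => exact ⟨0, by simp⟩
  | cons a V ih =>
    obtain ⟨M, hM⟩ := ih
    refine ⟨|M| + |a.1| + |a.2| + 1, ?_⟩
    intro v hv
    have := le_abs_self M
    have := le_abs_self a.1
    have := le_abs_self a.2
    have := neg_abs_le a.1
    have := neg_abs_le a.2
    have := abs_nonneg M
    rcases List.mem_cons.1 hv with rfl | hv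
    · omega
    · have := hM v hv; omega

theorem wnd_far {V : List (ℤ × ℤ)} {M : ℤ} (hM : ∀ v ∈ V, v.1 < M ∧ v.2 < M ∧ -M < v.1 ∧ -M < v.2)
    (f : ℤ × ℤ) (hf : M ≤ f.1 ∨ M ≤ f.2 ∨ f.2 ≤ -M) : wnd V f = 0 := by
  unfold wnd csum
  apply wsum_zero
  intro x hx y hy
  rw [mem_clo] at hx hy
  have := hM x hx
  have := hM y hy
  unfold crs
  split_ifs <;> omega

theorem wnd_far_left {V : List (ℤ × ℤ)} (hV : Cyc V) {M : ℤ}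
    (hM : ∀ v ∈ V, v.1 < M ∧ v.2 < M ∧ -M < v.1 ∧ -M < v.2)
    (f : ℤ × ℤ) (hf : f.1 ≤ -M) : wnd V f = 0 := by
  obtain ⟨a, b⟩ := f
  have : ∀ n : ℕ, wnd V (a, -M + n) = 0 := by
    intro n
    induction n with
    | zero => exact wnd_far hM _ (by simp)
    | succ n ih =>
      rw [wnd_v hV, enet_not_mem]
      · push_cast; rw [show -M + ((n:ℤ)+1) - 1 = -M + n by ring, ih]; rfl
      · intro h; have := hM _ h; simp only at *; omega
  by_cases hb : -M ≤ b
  · have := this (b + M).toNat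
    rwa [show -M + ((b + M).toNat : ℤ) = b by omega] at this
  · exact wnd_far hM _ (by simp only; omega)

theorem wnd_finite {V : List (ℤ × ℤ)} (hV : Cyc V) : {f | wnd V f ≠ 0}.Finite := by
  obtain ⟨M, hM⟩ := bdd V
  apply (Set.finite_Icc ((-M, -M) : ℤ × ℤ) (M, M)).subset
  intro f hf
  rw [Set.mem_Icc, Prod.le_def, Prod.le_def]
  simp only [Set.mem_ofPred_eq] at *
  by_contra hc
  apply hf
  by_cases h : f.1 ≤ -M
  · exact wnd_far_left hV hM f h
  · exact wnd_far hM f (by omega)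

theorem jordan {V : List (ℤ × ℤ)} (hV : Cyc V) :
    (∀ f, wnd V f = 0 ∨ wnd V f = 1) ∨ (∀ f, wnd V f = 0 ∨ wnd V f = -1) := by
  obtain ⟨M, hM⟩ := bdd V
  set k := fval (wnd V) V with hk
  have key : ∀ b : ℤ, ∀ n : ℕ, wnd V (M - n, b) = 0 ∨
      ((k = 0 ∨ k = 1) ∧ (wnd V (M - n, b) = k ∨ wnd V (M - n, b) = k - 1)) := by
    intro b n
    induction n with
    | zero => left; exact wnd_far hM _ (by simp)
    | succ n ih =>
      have hw := wnd_h V (M - n) b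
      rw [show M - ((n + 1 : ℕ) : ℤ) = M - n - 1 by push_cast; ring]
      have l1 : lface (M - n, b) (M - n, b + 1) = (M - n - 1, b) := by
        unfold lface; ext <;> simp only <;> omega
      have l2 : lface (M - n, b + 1) (M - n, b) = (M - n, b) := by
        unfold lface; ext <;> simp only <;> omega
      rcases enet_range hV (M - n, b) (M - n, b + 1) with he | he | he
      · rw [hw, he, add_zero]; exact ih
      · have := edge_val hV he
        rw [l1, l2] at this
        omega
      · rw [enet_anti] at he
        have := edge_val hV (u := (M - n, b + 1)) (v := (M - n, b)) (by omega)
        rw [l1, l2] at this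
        omega
  have all : ∀ f, wnd V f = 0 ∨ ((k = 0 ∨ k = 1) ∧ (wnd V f = k ∨ wnd V f = k - 1)) := by
    rintro ⟨a, b⟩
    by_cases h : a ≤ M
    · have := key b (M - a).toNat
      rwa [show M - ((M - a).toNat : ℤ) = a by omega] at this
    · left; exact wnd_far hM _ (by simp only; omega)
  by_cases h1 : k = 1
  · left; intro f; have := all f; omega
  · right; intro f; have := all f; omega

theorem theta {V : List (ℤ × ℤ)} (hV : Cyc V) (h01 : ∀ f, wnd V f = 0 ∨ wnd V f = 1)
    {p q : ℤ × ℤ} (hp : p ∈ V) (hq : q ∈ V) (hpq : p ≠ q) (Z : List (ℤ × ℤ)) (hZ : Z.Nodup)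
    (hZV : ∀ z ∈ Z, z ∉ V) (hch : (p :: Z ++ [q]).IsChain plusAdj) (z T) (hz : Z ++ [q] = z :: T)
    (he : enet V p z = 0) (hw : wnd V (lface p z) = 0) :
    ∃ V', Cyc V' ∧ (∀ x ∈ V', x ∈ V ∨ x ∈ Z) ∧ (∀ f, wnd V' f = 0 ∨ wnd V' f = 1) ∧
      (∀ f, wnd V f ≤ wnd V' f) ∧ ∃ f, wnd V f < wnd V' f := by
  have hpz : plusAdj p z := by
    rw [List.cons_append, hz, List.isChain_cons_cons] at hch; exact hch.1
  have hw' : wnd V (lface z p) = 0 := by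
    have := flux hV hpz; omega
  obtain ⟨l, hl, hE⟩ := rot_head hV hp
  have hql : q ∈ l := by
    have := (hE.1 q).1 hq
    simp at this; grind
  obtain ⟨X, Y, rfl⟩ := List.append_of_mem hql
  have hX : Z = [] → X ≠ [] := by
    rintro rfl rfl
    simp at hz
    obtain ⟨rfl, rfl⟩ := hz
    have := enet_first (l := Y) (by simpa using hl)
    rw [hE.enet_eq] at he
    simp at he; omega
  have hY : Z = [] → Y ≠ [] := by
    rintro rfl rfl
    simp at hz
    obtain ⟨rfl, rfl⟩ := hz
    have r := rot_split p X q [] (by simpa using hl)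
    have := enet_first (l := X) (by simpa using r.1)
    have e := (hE.trans r.2).enet_eq q p
    simp at e
    rw [enet_anti] at he
    omega
  have hdis : ∀ z ∈ Z, z ≠ p ∧ z ≠ q ∧ z ∉ X ∧ z ∉ Y := by
    intro z hz
    have := hZV z hz
    rw [hE.1 z] at this
    simp at this
    tauto
  have hn := hl.2.1
  have hc := hl.2.2
  rw [← List.cons_append, chain_two] at hc
  have hrev : q :: Z.reverse ++ [p] = (p :: Z ++ [q]).reverse := by simp
  have c1 : Cyc (p :: X ++ q :: Z.reverse) := by
    refine ⟨?_, ?_, ?_⟩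
    · rcases X with _ | ⟨_, _⟩ <;> rcases Z with _ | ⟨_, _⟩ <;> simp at * <;> omega
    · simp [List.nodup_append] at *
      grind
    · rw [chain_two]
      refine ⟨hc.1, ?_⟩
      rw [hrev, List.isChain_reverse]
      exact hch.imp (fun a b h => plusAdj_symm h)
  have c2 : Cyc (p :: Z ++ q :: Y) := by
    refine ⟨?_, ?_, ?_⟩
    · rcases Y with _ | ⟨_, _⟩ <;> rcases Z with _ | ⟨_, _⟩ <;> simp at * <;> omega
    · simp [List.nodup_append] at *
      grind
    · rw [chain_two]
      exact ⟨hch, hc.2⟩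
  have hsum : ∀ f, wnd V f = wnd (p :: X ++ q :: Z.reverse) f + wnd (p :: Z ++ q :: Y) f := by
    intro f
    rw [hE.wnd_eq]
    unfold wnd
    rw [← List.cons_append, csum_two, csum_two, csum_two, hrev, wsum_reverse _ (crs_anti f)]
    ring
  have e2 : enet (p :: Z ++ q :: Y) p z = 1 := by
    have : p :: Z ++ q :: Y = p :: z :: (T ++ Y) := by
      have : p :: Z ++ q :: Y = p :: (Z ++ [q]) ++ Y := by simp
      rw [this, hz]; simp
    rw [this] at c2 ⊢
    exact enet_first c2
  have f2 := flux c2 hpz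
  have ⟨g, hg0, hg⟩ : ∃ g, wnd V g = 0 ∧ wnd (p :: Z ++ q :: Y) g ≠ 0 := by
    by_cases h : wnd (p :: Z ++ q :: Y) (lface p z) = 0
    · exact ⟨_, hw', by omega⟩
    · exact ⟨_, hw, h⟩
  have hg' := hsum g
  rcases jordan c2 with j2 | j2
  · have j1 : ∀ f, wnd (p :: X ++ q :: Z.reverse) f = 0 ∨ wnd (p :: X ++ q :: Z.reverse) f = -1 := by
      rcases jordan c1 with j1 | j1
      · have := j1 g; have := j2 g; omega
      · exact j1
    refine ⟨_, c2, ?_, j2, ?_, g, ?_⟩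
    · intro x hx
      have := hE.1 x
      simp at *
      grind
    · intro f; have := hsum f; have := j1 f; omega
    · have := j2 g; omega
  · have j1 : ∀ f, wnd (p :: X ++ q :: Z.reverse) f = 0 ∨ wnd (p :: X ++ q :: Z.reverse) f = 1 := by
      rcases jordan c1 with j1 | j1
      · exact j1
      · have := j1 g; have := j2 g; omega
    refine ⟨_, c1, ?_, j1, ?_, g, ?_⟩
    · intro x hx
      have := hE.1 x
      simp at *
      grind
    · intro f; have := hsum f; have := j2 f; omega
    · have := j2 g; omega

def Flat (V : List (ℤ × ℤ)) (c : ℤ × ℤ) : Prop :=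
  ∀ b, plusAdj c b → wnd V (lface c b) = wnd V (lface b c)

theorem Flat.near {V : List (ℤ × ℤ)} {c : ℤ × ℤ} (h : Flat V c) (f : ℤ × ℤ)
    (h1 : c.1 - 1 ≤ f.1) (h2 : f.1 ≤ c.1) (h3 : c.2 - 1 ≤ f.2) (h4 : f.2 ≤ c.2) :
    wnd V f = wnd V c := by
  obtain ⟨a, b⟩ := c
  obtain ⟨x, y⟩ := f
  simp only at h1 h2 h3 h4
  have e1 := h (a + 1, b) (by rw [plusAdj_iff]; simp)
  have e2 := h (a - 1, b) (by rw [plusAdj_iff]; simp)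
  have e3 := h (a, b + 1) (by rw [plusAdj_iff]; simp)
  rw [show lface (a, b) (a + 1, b) = (a, b) by unfold lface; ext <;> simp only <;> omega,
    show lface (a + 1, b) (a, b) = (a, b - 1) by unfold lface; ext <;> simp only <;> omega] at e1
  rw [show lface (a, b) (a - 1, b) = (a - 1, b - 1) by unfold lface; ext <;> simp only <;> omega,
    show lface (a - 1, b) (a, b) = (a - 1, b) by unfold lface; ext <;> simp only <;> omega] at e2
  rw [show lface (a, b) (a, b + 1) = (a - 1, b) by unfold lface; ext <;> simp only <;> omega,
    show lface (a, b + 1) (a, b) = (a, b) by unfold lface; ext <;> simp only <;> omega] at e3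
  obtain rfl | rfl : x = a ∨ x = a - 1 := by omega
  · obtain rfl | rfl : y = b ∨ y = b - 1 := by omega
    · rfl
    · exact e1.symm
  · obtain rfl | rfl : y = b ∨ y = b - 1 := by omega
    · exact e3
    · exact e2.trans e3

theorem Flat.step {V : List (ℤ × ℤ)} {c d : ℤ × ℤ} (hc : Flat V c) (hd : Flat V d)
    (h : starAdj c d) : wnd V c = wnd V d := by
  rw [starAdj_iff] at h
  rw [← hc.near (min c.1 d.1, min c.2 d.2), ← hd.near (min c.1 d.1, min c.2 d.2)] <;>
    simp only <;> omega

theorem flat_not_mem {V : List (ℤ × ℤ)} (hV : Cyc V) {c : ℤ × ℤ} (hc : c ∉ V) : Flat V c := by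
  intro b hb
  rw [flux hV hb, enet_not_mem hc, add_zero]

theorem flat_chain {V : List (ℤ × ℤ)} (L : List (ℤ × ℤ)) (hL : L.IsChain starAdj)
    (hf : ∀ x ∈ L, Flat V x) (p) (hp : L.head? = some p) : ∀ x ∈ L, wnd V x = wnd V p := by
  induction L generalizing p with
  | nil => simp at hp
  | cons a L ih =>
    simp at hp
    subst hp
    rcases L with _ | ⟨b, L⟩
    · simp
    · rw [List.isChain_cons_cons] at hL
      have s := (hf a (by simp)).step (hf b (by simp)) hL.1
      have := ih hL.2 (fun x hx => hf x (List.mem_cons_of_mem _ hx)) b rfl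
      intro x hx
      rcases List.mem_cons.1 hx with rfl | hx
      · rfl
      · rw [this x hx, s]

theorem four_cycle {V : List (ℤ × ℤ)} (hV : Cyc V) {u v v' u' : ℤ × ℤ}
    (hu : u' ≠ u) (huv : v' ≠ v)
    (h1 : enet V u v = 1) (h2 : enet V v v' = 1) (h3 : enet V v' u' = 1) (h4 : enet V u' u = 1) :
    wnd V = wnd [u, v, v', u'] := by
  have hv : v ∈ V := by
    by_contra hv
    rw [enet_not_mem hv] at h2; omega
  obtain ⟨a, x, l, c, e⟩ := rot_mid hV hv
  have m := enet_mid c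
  have hx : x = v' := by
    have := m v'
    rw [← e.enet_eq, h2] at this
    by_contra hne
    rw [if_neg (Ne.symm hne)] at this
    split_ifs at this <;> omega
  have ha : a = u := by
    have := m u
    rw [← e.enet_eq, enet_anti, h1] at this
    by_contra hne
    rw [if_neg (Ne.symm hne)] at this
    split_ifs at this <;> omega
  subst hx ha
  have r := rot_split a [] v (x :: l) (by simpa using c)
  simp only [List.cons_append, List.nil_append] at r
  have e' := e.trans r.2
  rcases l with _ | ⟨w, l⟩
  · have := enet_mid r.1 u'
    simp only [List.nil_append] at e' 
    rw [← e'.enet_eq, h3, if_neg hu] at this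
    split_ifs at this <;> omega
  · have hw : w = u' := by
      simp only [List.cons_append] at e' r
      have := enet_mid r.1 u'
      rw [← e'.enet_eq, h3] at this
      by_contra hne
      rw [if_neg (Ne.symm hne)] at this
      split_ifs at this <;> omega
    subst hw
    rcases l with _ | ⟨t, l⟩
    · exact e.wnd_eq
    · exfalso
      have r2 := rot_split v [] x (w :: t :: l ++ [a]) (by simpa using r.1)
      simp only [List.cons_append, List.nil_append] at r2 e'
      have e2 := e'.trans r2.2
      have := enet_mid r2.1 a
      rw [← e2.enet_eq, h4] at this
      have hn := c.2.1
      rw [if_neg (by rintro rfl; simp at hn)] at this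
      split_ifs at this <;> omega

theorem wnd_four {u v v' u' : ℤ × ℤ} (h : plusAdj u v)
    (hu' : u' = (u.1 + (v.2 - u.2), u.2 - (v.1 - u.1)))
    (hv' : v' = (v.1 + (v.2 - u.2), v.2 - (v.1 - u.1))) :
    wnd [u, v, v', u'] (lface v u) = -1 := by
  obtain ⟨x1, x2⟩ := u
  obtain ⟨y1, y2⟩ := v
  subst hu' hv'
  rw [plusAdj_iff] at h
  simp only at h
  rcases h with h | h | h | h <;> obtain ⟨h1, h2⟩ := h <;> rw [h1, h2]
  · have e : lface (x1+1, x2) (x1, x2) = (x1, x2-1) := by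
      unfold lface; ext <;> simp only <;> omega
    rw [e]
    simp [wnd, csum, clo, wsum, crs]
    try omega
  · have e : lface (x1-1, x2) (x1, x2) = (x1-1, x2) := by
      unfold lface; ext <;> simp only <;> omega
    rw [e]
    simp [wnd, csum, clo, wsum, crs]
    try omega
  · have e : lface (x1, x2+1) (x1, x2) = (x1, x2) := by
      unfold lface; ext <;> simp only <;> omega
    rw [e]
    simp [wnd, csum, clo, wsum, crs]
    try omega
  · have e : lface (x1, x2-1) (x1, x2) = (x1-1, x2-1) := by
      unfold lface; ext <;> simp only <;> omega
    rw [e]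
    simp [wnd, csum, clo, wsum, crs]
    try omega

theorem fill {A : Set (ℤ × ℤ)} {V : List (ℤ × ℤ)} (hV : Cyc V) (hA : ∀ x ∈ V, x ∈ A)
    (h01 : ∀ f, wnd V f = 0 ∨ wnd V f = 1)
    (hmax : ∀ V', Cyc V' → (∀ x ∈ V', x ∈ A) → (∀ f, wnd V' f = 0 ∨ wnd V' f = 1) →
      (∀ f, wnd V f ≤ wnd V' f) → ¬ ∃ f, wnd V f < wnd V' f)
    {u v : ℤ × ℤ} (h : plusAdj u v) (hl : wnd V (lface u v) = 1) (hr : wnd V (lface v u) = 0)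
    (hu'A : (u.1 + (v.2 - u.2), u.2 - (v.1 - u.1)) ∈ A)
    (hv'A : (v.1 + (v.2 - u.2), v.2 - (v.1 - u.1)) ∈ A) : False := by
  have nt : ∀ (p q : ℤ × ℤ), p ∈ V → q ∈ V → p ≠ q → ∀ Z : List (ℤ × ℤ), Z.Nodup →
      (∀ z ∈ Z, z ∉ V) → (∀ z ∈ Z, z ∈ A) → (p :: Z ++ [q]).IsChain plusAdj →
      ∀ z T, Z ++ [q] = z :: T → enet V p z = 0 → wnd V (lface p z) = 0 → False := by
    intro p q hp hq hpq Z hZ hZV hZA hch z T hz he hw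
    obtain ⟨V', a1, a2, a3, a4, a5⟩ := theta hV h01 hp hq hpq Z hZ hZV hch z T hz he hw
    exact hmax V' a1 (fun x hx => (a2 x hx).elim (hA x) (hZA x)) a3 a4 a5
  have e1 : enet V u v = 1 := by have := flux hV h; omega
  have huV : u ∈ V := by
    by_contra hu
    rw [enet_not_mem hu] at e1; omega
  have hvV : v ∈ V := by
    by_contra hu
    rw [enet_anti, enet_not_mem hu] at e1; omega
  have w4 := wnd_four h rfl rfl
  have geo : ∃ u' v', u' = (u.1 + (v.2 - u.2), u.2 - (v.1 - u.1)) ∧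
      v' = (v.1 + (v.2 - u.2), v.2 - (v.1 - u.1)) ∧ plusAdj u u' ∧ plusAdj u' v' ∧
      plusAdj v' v ∧ u ≠ v ∧ u ≠ u' ∧ u ≠ v' ∧ v ≠ u' ∧ v ≠ v' ∧ u' ≠ v' ∧
      lface u u' = lface v u ∧ lface u' v' = lface v u ∧ lface v' v = lface v u := by
    refine ⟨_, _, rfl, rfl, ?_⟩
    obtain ⟨x1, x2⟩ := u
    obtain ⟨y1, y2⟩ := v
    rw [plusAdj_iff] at *
    rw [plusAdj_iff, plusAdj_iff]
    simp only [lface, Prod.mk.injEq, ne_eq] at *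
    rcases h with h | h | h | h <;> refine ⟨?_, ?_, ?_, ?_, ?_, ?_, ?_, ?_, ?_, ?_, ?_, ?_⟩ <;> omega
  obtain ⟨u', v', hu', hv', a1, a2, a3, n1, n2, n3, n4, n5, n6, l1, l2, l3⟩ := geo
  rw [← hu'] at hu'A w4
  rw [← hv'] at hv'A w4
  by_cases mu : u' ∈ V <;> by_cases mv : v' ∈ V
  · have g1 : enet V u u' ≠ 0 := fun he =>
      nt u u' huV mu n2 [] (by simp) (by simp) (by simp) (by simpa using a1) u' [] rfl he (by rw [l1, hr])
    have g2 : enet V u' v' ≠ 0 := fun he =>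
      nt u' v' mu mv n6 [] (by simp) (by simp) (by simp) (by simpa using a2) v' [] rfl he (by rw [l2, hr])
    have g3 : enet V v' v ≠ 0 := fun he =>
      nt v' v mv hvV n5.symm [] (by simp) (by simp) (by simp) (by simpa using a3) v [] rfl he
        (by rw [l3, hr])
    have f1 := flux hV a1
    have f2 := flux hV a2
    have f3 := flux hV a3
    rw [l1, hr] at f1
    rw [l2, hr] at f2
    rw [l3, hr] at f3
    have := h01 (lface u' u)
    have := h01 (lface v' u')
    have := h01 (lface v v')
    have s1 := enet_anti V u u'
    have s2 := enet_anti V u' v'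
    have s3 := enet_anti V v' v
    have r1 := enet_range hV u u'
    have r2 := enet_range hV u' v'
    have r3 := enet_range hV v' v
    have := four_cycle hV n2.symm n5.symm e1 (v' := v') (u' := u') (by omega) (by omega) (by omega)
    rw [this, w4] at hr
    omega
  · exact nt u' v mu hvV n4.symm [v'] (by simp) (by simpa using mv) (by simpa using hv'A)
      (by simp [a2, a3]) v' [v] rfl (by rw [enet_anti, enet_not_mem mv, neg_zero]) (by rw [l2, hr])
  · exact nt u v' huV mv n3 [u'] (by simp) (by simpa using mu) (by simpa using hu'A)
      (by simp [a1, a2]) u' [v'] rfl (by rw [enet_anti, enet_not_mem mu, neg_zero]) (by rw [l1, hr])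
  · exact nt u v huV hvV n1 [u', v'] (by simp [n6]) (by simp [mu, mv]) (by simp [hu'A, hv'A])
      (by simp [a1, a2, a3]) u' [v', v] rfl (by rw [enet_anti, enet_not_mem mu, neg_zero])
      (by rw [l1, hr])

theorem flat_block {A : Set (ℤ × ℤ)} {V : List (ℤ × ℤ)} (hV : Cyc V) (hA : ∀ x ∈ V, x ∈ A)
    (h01 : ∀ f, wnd V f = 0 ∨ wnd V f = 1)
    (hmax : ∀ V', Cyc V' → (∀ x ∈ V', x ∈ A) → (∀ f, wnd V' f = 0 ∨ wnd V' f = 1) →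
      (∀ f, wnd V f ≤ wnd V' f) → ¬ ∃ f, wnd V f < wnd V' f)
    {c : ℤ × ℤ} (hc : ∀ y : ℤ × ℤ, c.1 - 1 ≤ y.1 → y.1 ≤ c.1 + 1 → c.2 - 1 ≤ y.2 → y.2 ≤ c.2 + 1 →
      y ∈ A) : Flat V c := by
  intro b hb
  have hb' := hb
  rw [plusAdj_iff] at hb'
  rcases h01 (lface c b) with h1 | h1 <;> rcases h01 (lface b c) with h2 | h2
  · rw [h1, h2]
  · exact (fill hV hA h01 hmax (plusAdj_symm hb) h2 h1
      (hc _ (by simp only; omega) (by simp only; omega) (by simp only; omega) (by simp only; omega))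
      (hc _ (by simp only; omega) (by simp only; omega) (by simp only; omega)
        (by simp only; omega))).elim
  · exact (fill hV hA h01 hmax hb h1 h2
      (hc _ (by simp only; omega) (by simp only; omega) (by simp only; omega) (by simp only; omega))
      (hc _ (by simp only; omega) (by simp only; omega) (by simp only; omega)
        (by simp only; omega))).elim
  · rw [h1, h2]

def ring0 : List (ℤ × ℤ) := [(1,0),(1,1),(0,1),(-1,1),(-1,0),(-1,-1),(0,-1),(1,-1)]

theorem cyc_ring0 : Cyc ring0 := by
  refine ⟨by simp [ring0], by simp [ring0], ?_⟩
  simp [ring0, clo, plusAdj]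

theorem wnd_ring0 : wnd ring0 (0, 0) = 1 := by
  simp [ring0, wnd, csum, clo, wsum, crs]

theorem exists_max_cycle {A : Set (ℤ × ℤ)} (hfin : A.Finite)
    (hA : ∀ y : ℤ × ℤ, -1 ≤ y.1 → y.1 ≤ 1 → -1 ≤ y.2 → y.2 ≤ 1 → y ∈ A) :
    ∃ V, Cyc V ∧ (∀ x ∈ V, x ∈ A) ∧ (∀ f, wnd V f = 0 ∨ wnd V f = 1) ∧ wnd V (0, 0) = 1 ∧
     (∀ V', Cyc V' → (∀ x ∈ V', x ∈ A) → (∀ f, wnd V' f = 0 ∨ wnd V' f = 1) →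
      (∀ f, wnd V f ≤ wnd V' f) → ¬ ∃ f, wnd V f < wnd V' f) := by
  obtain ⟨M, hM⟩ := bdd hfin.toFinset.toList
  have hM' : ∀ v ∈ A, v.1 < M ∧ v.2 < M ∧ -M < v.1 ∧ -M < v.2 := fun v hv => hM v (by simpa using hv)
  let G : Set (Set (ℤ × ℤ)) := {S | ∃ V, (Cyc V ∧ (∀ x ∈ V, x ∈ A) ∧
    (∀ f, wnd V f = 0 ∨ wnd V f = 1) ∧ wnd V (0, 0) = 1) ∧ S = {f | wnd V f ≠ 0}}
  have hG : G.Finite := by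
    apply (Set.finite_Icc ((-M, -M) : ℤ × ℤ) (M, M)).finite_subsets.subset
    rintro S ⟨V, ⟨hV, hVA, -, -⟩, rfl⟩ f hf
    have hMV : ∀ v ∈ V, v.1 < M ∧ v.2 < M ∧ -M < v.1 ∧ -M < v.2 := fun v hv => hM' v (hVA v hv)
    rw [Set.mem_Icc, Prod.le_def, Prod.le_def]
    simp only [Set.mem_ofPred_eq] at *
    by_contra hc
    apply hf
    by_cases h : f.1 ≤ -M
    · exact wnd_far_left hV hMV f h
    · exact wnd_far hMV f (by omega)
  have hne : G.Nonempty := by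
    refine ⟨_, ring0, ⟨cyc_ring0, ?_, ?_, wnd_ring0⟩, rfl⟩
    · intro x hx
      apply hA <;> simp [ring0] at hx <;> rcases hx with h | h | h | h | h | h | h | h <;> simp [h]
    · rcases jordan cyc_ring0 with j | j
      · exact j
      · have := j (0, 0); rw [wnd_ring0] at this; omega
  obtain ⟨S, hS⟩ := hG.exists_maximal hne
  obtain ⟨⟨V, ⟨h1, h2, h3, h4⟩, rfl⟩, hmax⟩ := hS
  refine ⟨V, h1, h2, h3, h4, ?_⟩
  rintro V' c1 c2 c3 c4 ⟨f, hf⟩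
  have g0 : wnd V' (0, 0) = 1 := by have := c4 (0, 0); have := c3 (0, 0); omega
  have := hmax (y := {f | wnd V' f ≠ 0}) ⟨V', ⟨c1, c2, c3, g0⟩, rfl⟩ (by
    intro g hg
    simp only [Set.mem_ofPred_eq] at *
    have := c4 g; have := h3 g; omega)
  have h := @this f (by simp only [Set.mem_ofPred_eq]; have := h3 f; omega)
  simp only [Set.mem_ofPred_eq] at h
  have := h3 f; have := c3 f; omega

theorem mem_C0_of_path {ω : ℤ × ℤ → Bool} {L : List (ℤ × ℤ)} (h1 : L.Nodup)
    (h2 : L.IsChain starAdj) (h3 : L.head? = some (0, 0)) (h5 : ∀ x ∈ L, x ∉ {x | ω x = false})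
    {x} (hx : x ∈ L) : x ∈ C0 ω := by
  refine ⟨by simpa using h5 x hx, ?_⟩
  obtain ⟨X, Y, rfl⟩ := List.append_of_mem hx
  have e : X ++ x :: Y = (X ++ [x]) ++ Y := by simp
  rw [e] at h1 h2 h3 h5
  refine ⟨X ++ [x], (List.nodup_append.1 h1).1, (List.isChain_append.1 h2).1, ?_, by simp, ?_⟩
  · rcases X with _ | ⟨a, X⟩ <;> simpa using h3
  · intro y hy; exact h5 y (List.mem_append_left _ hy)

theorem C0_ext {ω : ℤ × ℤ → Bool} {c d} (hc : c ∈ C0 ω) (h : starAdj d c) (hd : ω d = true) :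
    d ∈ C0 ω := by
  obtain ⟨-, L, h1, h2, h3, h4, h5⟩ := hc
  by_cases hm : d ∈ L
  · exact mem_C0_of_path h1 h2 h3 h5 hm
  · apply mem_C0_of_path (L := L ++ [d]) (ω := ω) _ _ _ _ (by simp)
    · rw [List.nodup_append]; grind
    · change L.IsChain starAdj at h2
      rw [List.isChain_append]
      refine ⟨h2, by simp, ?_⟩
      intro x hx y hy
      rw [h4] at hx
      simp at hx hy
      subst hx hy
      rw [starAdj_iff] at *; omega
    · rcases L with _ | ⟨a, L⟩
      · simp at h3
      · simpa using h3
    · intro x hx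
      rcases List.mem_append.1 hx with hx | hx
      · exact h5 x hx
      · simp at hx; subst hx; simp [hd]

theorem isPlusCycle_of_cyc {V : List (ℤ × ℤ)} (h : Cyc V) : IsPlusCycle V := by
  obtain ⟨h1, h2, h3⟩ := h
  rcases V with _ | ⟨a, l⟩
  · simp at h1
  rw [clo_cons, List.isChain_append] at h3
  refine ⟨by simp, h2, h3.1, a, (a :: l).getLast (by simp), rfl, ?_, ?_⟩
  · exact List.getLast?_eq_some_getLast _
  · exact h3.2.2 _ (by rw [List.getLast?_eq_some_getLast (by simp)]; rfl) a (by simp)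

theorem surrounds_of_wnd {V : List (ℤ × ℤ)} (hV : Cyc V) {x} (hx : x ∉ V) (h : wnd V x ≠ 0) :
    surrounds {x | x ∈ V} x := by
  refine ⟨hx, (wnd_finite hV).subset ?_⟩
  rintro k ⟨L, h1, h2, h3, h4, h5⟩
  have := flat_chain L h2 (fun y hy => flat_not_mem hV (h5 y hy)) x h3 k (List.mem_of_getLast? h4)
  simp only [Set.mem_ofPred_eq]
  rw [this]; exact h


/-- If `S₀` is occupied and `C(0)` is finite, there is a plus connected S-cycle of
vacant squares, each star adjacent to some square of `C(0)`, whose square set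
surrounds every square of `C(0)` and also surrounds every vacant square star
adjacent to `C(0)` that does not belong to the cycle. -/
theorem exists_vacant_plus_cycle_surrounding_all
    (ω : ℤ × ℤ → Bool) (h0 : ω (0, 0) = true) (hfin : (C0 ω).Finite) :
    ∃ V : List (ℤ × ℤ), IsPlusCycle V ∧
      (∀ v ∈ V, ω v = false ∧ ∃ c ∈ C0 ω, starAdj v c) ∧
      (∀ c ∈ C0 ω, surrounds {x | x ∈ V} c) ∧
      (∀ y : ℤ × ℤ, ω y = false → (∃ c ∈ C0 ω, starAdj y c) → y ∉ V →
        surrounds {x | x ∈ V} y) := by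

  set A : Set (ℤ × ℤ) := {y | ∃ c ∈ C0 ω, c.1 - 1 ≤ y.1 ∧ y.1 ≤ c.1 + 1 ∧ c.2 - 1 ≤ y.2 ∧
    y.2 ≤ c.2 + 1} with hA
  have h0C : ((0, 0) : ℤ × ℤ) ∈ C0 ω :=
    ⟨h0, [(0, 0)], by simp, List.isChain_singleton _, rfl, rfl, by simp [h0]⟩
  have hAfin : A.Finite := by
    have : A ⊆ ⋃ c ∈ C0 ω, Set.Icc ((c.1 - 1, c.2 - 1) : ℤ × ℤ) (c.1 + 1, c.2 + 1) := by
      rintro y ⟨c, hc, h⟩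
      rw [Set.mem_iUnion₂]
      refine ⟨c, hc, ?_⟩
      rw [Set.mem_Icc, Prod.le_def, Prod.le_def]
      simp only
      omega
    exact (hfin.biUnion (fun c _ => Set.finite_Icc _ _)).subset this
  obtain ⟨V, hV, hVA, h01, hw0, hmax⟩ := exists_max_cycle hAfin
    (fun y a b c d => ⟨(0, 0), h0C, by simp only; omega⟩)
  have hflat : ∀ c ∈ C0 ω, Flat V c := fun c hc =>
    flat_block hV hVA h01 hmax (fun y a b d e => ⟨c, hc, a, b, d, e⟩)
  have hw : ∀ c ∈ C0 ω, wnd V c = 1 := by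
    intro c hc
    obtain ⟨-, L, h1, h2, h3, h4, h5⟩ := hc
    rw [← hw0]
    exact flat_chain L h2 (fun x hx => hflat x (mem_C0_of_path h1 h2 h3 h5 hx)) _ h3 c
      (List.mem_of_getLast? h4)
  have hdisj : ∀ c ∈ C0 ω, c ∉ V := by
    intro c hc hcV
    obtain ⟨v, -, e1, -, -, e2, -⟩ := edge_next hV hcV
    have f := flux hV e2
    have := hflat c hc v e2
    omega
  have hst : ∀ y c : ℤ × ℤ, c ∈ C0 ω → y ∉ C0 ω → c.1 - 1 ≤ y.1 → y.1 ≤ c.1 + 1 → c.2 - 1 ≤ y.2 →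
      y.2 ≤ c.2 + 1 → starAdj y c := by
    intro y c hc hy _ _ _ _
    rw [starAdj_iff]
    refine ⟨by omega, ?_⟩
    rintro ⟨e1, e2⟩
    exact hy (by rwa [Prod.ext e1 e2])
  refine ⟨V, isPlusCycle_of_cyc hV, ?_, ?_, ?_⟩
  · intro v hv
    have hvC : v ∉ C0 ω := fun h => hdisj v h hv
    obtain ⟨c, hc, a1, a2, a3, a4⟩ := hVA v hv
    have s := hst v c hc hvC a1 a2 a3 a4
    refine ⟨?_, c, hc, s⟩
    by_contra hne
    exact hvC (C0_ext hc s (by simpa using hne))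
  · intro c hc
    exact surrounds_of_wnd hV (hdisj c hc) (by rw [hw c hc]; norm_num)
  · rintro y - ⟨c, hc, s⟩ hyV
    apply surrounds_of_wnd hV hyV
    rw [(flat_not_mem hV hyV).step (hflat c hc) s, hw c hc]
    norm_num
end
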